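/- Fix k ≥ 0, set l := 2^{⌈log₂(k+2)⌉}, let t be a positive integer, and let X_k := X ⊗ₖ I_{2^k}. For arbitrary parameter vectors θ^{(0)}, …, θ^{(t·l−1)} ∈ ℝ^{k+1} and every b ∈ {0,1}^{t·l}, define G(b) := (Lay_k(θ^{(t·l−1)}) · X_k^{b_{t·l−1}}) · ⋯ · (Lay_k(θ^{(0)}) · X_k^{b_0}). Then G(b) = G(b̄), where b̄ is the bitwise complement of b. -/

import Mathlib

open Matrix

noncomputable section

/-- The single-qubit rotation gate `RX θ`. -/
def RXg (θ : ℝ) : Matrix (Fin 2) (Fin 2) ℂ :=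
  !![(Real.cos (θ / 2) : ℂ), -Complex.I * (Real.sin (θ / 2) : ℂ);
     -Complex.I * (Real.sin (θ / 2) : ℂ), (Real.cos (θ / 2) : ℂ)]

/-- The embedded CX gate `I ⊗ₖ CX ⊗ₖ I` with control qubit `c` and target qubit `t`,
as a matrix on the basis states `Fin n → Fin 2` (qubit `0` being the last Kronecker factor). -/
def CXe {n : ℕ} (c t : Fin n) : Matrix (Fin n → Fin 2) (Fin n → Fin 2) ℂ :=
  fun u v => if u = Function.update v t (v t + v c) then 1 else 0

/-- The Kronecker product `RX θ_{n-1} ⊗ₖ ⋯ ⊗ₖ RX θ_0`. -/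
def RXall {n : ℕ} (θ : Fin n → ℝ) : Matrix (Fin n → Fin 2) (Fin n → Fin 2) ℂ :=
  fun u v => ∏ i, RXg (θ i) (u i) (v i)

/-- The linear entanglement layer `M_1 · M_2 · ⋯ · M_{n-1}`,
where `M_j` is the CX gate with control qubit `j` and target qubit `j-1`. -/
def Elin (n : ℕ) : Matrix (Fin n → Fin 2) (Fin n → Fin 2) ℂ :=
  ((List.finRange (n - 1)).map (fun j =>
    CXe (n := n) ⟨j.val + 1, by have := j.isLt; omega⟩ ⟨j.val, by have := j.isLt; omega⟩)).prod

/-- The single-layer `n`-qubit RX-CX unitary with linear entanglement. -/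
def LayU (n : ℕ) (θ : Fin n → ℝ) : Matrix (Fin n → Fin 2) (Fin n → Fin 2) ℂ :=
  Elin n * RXall θ

/-- Splitting `k+1` qubits according to the value of the top qubit (the first
Kronecker factor, i.e. qubit `k`): `Sum.inl` corresponds to top-qubit value `0`. -/
def splitE (k : ℕ) : ((Fin k → Fin 2) ⊕ (Fin k → Fin 2)) ≃ (Fin (k + 1) → Fin 2) where
  toFun := Sum.elim (fun u => Fin.snoc u 0) (fun u => Fin.snoc u 1)
  invFun v := if v (Fin.last k) = 0 then Sum.inl (Fin.init v) else Sum.inr (Fin.init v)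
  left_inv := by
    rintro (u | u) <;> simp [Fin.snoc_last, Fin.init_snoc]
  right_inv := by
    intro v
    dsimp only
    by_cases h : v (Fin.last k) = 0
    · rw [if_pos h]
      exact h ▸ Fin.snoc_init_self v
    · rw [if_neg h]
      have h1 : v (Fin.last k) = 1 := by
        have h2 := (v (Fin.last k)).isLt
        have h3 : (v (Fin.last k)).val ≠ 0 := fun hc => h (Fin.ext hc)
        apply Fin.ext
        omega
      exact h1 ▸ Fin.snoc_init_self v

/-- `X_k := X ⊗ₖ I_{2^k} = Matrix.fromBlocks 0 I I 0`, the bit flip on the top qubit of `k+1` qubits. -/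
def XtopM (k : ℕ) : Matrix (Fin (k + 1) → Fin 2) (Fin (k + 1) → Fin 2) ℂ :=
  Matrix.reindex (splitE k) (splitE k)
    (Matrix.fromBlocks 0 (1 : Matrix (Fin k → Fin 2) (Fin k → Fin 2) ℂ) 1 0)

/-- `G(b) = (Lay_k(θ^{(N-1)}) · X_k^{b_{N-1}}) · ⋯ · (Lay_k(θ^{(0)}) · X_k^{b_0})`. -/
def Gfun (k : ℕ) {N : ℕ} (θ : Fin N → (Fin (k + 1) → ℝ)) (b : Fin N → Bool) :
    Matrix (Fin (k + 1) → Fin 2) (Fin (k + 1) → Fin 2) ℂ :=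
  ((List.finRange N).reverse.map (fun j => LayU (k + 1) (θ j) * (XtopM k) ^ (b j).toNat)).prod

/-- The zero-one matrix sending the basis state `v` to the basis state `f v`. -/
def basisMap {n : ℕ} (f : (Fin n → Fin 2) → Fin n → Fin 2) :
    Matrix (Fin n → Fin 2) (Fin n → Fin 2) ℂ :=
  fun u v => if u = f v then 1 else 0

lemma mul_basisMap_apply {n : ℕ} (A : Matrix (Fin n → Fin 2) (Fin n → Fin 2) ℂ)
    (f : (Fin n → Fin 2) → Fin n → Fin 2) (u v : Fin n → Fin 2) :
    (A * basisMap f) u v = A u (f v) := by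
  simp [Matrix.mul_apply, basisMap]

lemma basisMap_mul {n : ℕ} (f g : (Fin n → Fin 2) → Fin n → Fin 2) :
    basisMap f * basisMap g = basisMap (f ∘ g) := by
  ext u v
  rw [mul_basisMap_apply]
  rfl

lemma basisMap_id {n : ℕ} : basisMap (id : (Fin n → Fin 2) → Fin n → Fin 2) = 1 := by
  ext u v
  simp [basisMap, Matrix.one_apply]

/-- The Pauli-`X` string flipping the qubits in the support of `a`. -/
def bitFlip {n : ℕ} (a : Fin n → Fin 2) : Matrix (Fin n → Fin 2) (Fin n → Fin 2) ℂ :=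
  basisMap (fun v => a + v)

lemma bitFlip_zero {n : ℕ} : bitFlip (0 : Fin n → Fin 2) = 1 := by
  rw [← basisMap_id]
  simp only [bitFlip, zero_add]
  rfl

lemma bitFlip_add {n : ℕ} (a b : Fin n → Fin 2) : bitFlip (a + b) = bitFlip a * bitFlip b := by
  simp only [bitFlip, basisMap_mul]
  congr 1
  ext v : 1
  exact add_assoc a b v

lemma bits_add_self {n : ℕ} (a : Fin n → Fin 2) : a + a = 0 := by
  ext i : 1
  exact (by decide : ∀ x : Fin 2, x + x = 0) (a i)

lemma bitFlip_mul_apply {n : ℕ} (a : Fin n → Fin 2)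
    (A : Matrix (Fin n → Fin 2) (Fin n → Fin 2) ℂ) (u v : Fin n → Fin 2) :
    (bitFlip a * A) u v = A (a + u) v := by
  have h (w : Fin n → Fin 2) : u = a + w ↔ a + u = w := by
    constructor <;> rintro rfl <;> rw [← add_assoc, bits_add_self, zero_add]
  simp [Matrix.mul_apply, bitFlip, basisMap, h]

lemma basisMap_mul_bitFlip {n : ℕ} (f : AddMonoid.End (Fin n → Fin 2)) (a : Fin n → Fin 2) :
    basisMap f * bitFlip a = bitFlip (f a) * basisMap f := by
  simp only [bitFlip, basisMap_mul]
  congr 1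
  ext v : 1
  exact map_add f a v

lemma RXall_mul_bitFlip {n : ℕ} (θ : Fin n → ℝ) (a : Fin n → Fin 2) :
    RXall θ * bitFlip a = bitFlip a * RXall θ := by
  ext u v
  rw [bitFlip_mul_apply, bitFlip, mul_basisMap_apply]
  refine Finset.prod_congr rfl fun i _ => ?_
  have h (x y z : Fin 2) : RXg (θ i) x (z + y) = RXg (θ i) (z + x) y := by
    fin_cases x <;> fin_cases y <;> fin_cases z <;> simp [RXg]
  exact h _ _ _

/-- The action of the CX gate on bit strings. -/
def cxHom {n : ℕ} (c t : Fin n) : AddMonoid.End (Fin n → Fin 2) where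
  toFun v := Function.update v t (v t + v c)
  map_zero' := by simp
  map_add' u v := by
    ext i : 1
    rcases eq_or_ne i t with rfl | h
    · simp [add_add_add_comm]
    · simp [h]

/-- The action of the linear entanglement layer on bit strings. -/
def linHom (n : ℕ) : AddMonoid.End (Fin n → Fin 2) :=
  ((List.finRange (n - 1)).map (fun j =>
    cxHom (n := n) ⟨j.val + 1, by have := j.isLt; omega⟩ ⟨j.val, by have := j.isLt; omega⟩)).prod

lemma basisMap_list_prod {n : ℕ} (l : List (AddMonoid.End (Fin n → Fin 2))) :
    basisMap l.prod = (l.map fun f : AddMonoid.End (Fin n → Fin 2) => basisMap f).prod := by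
  induction l with
  | nil => exact basisMap_id
  | cons f l ih =>
    rw [List.prod_cons, List.map_cons, List.prod_cons, ← ih, basisMap_mul]
    rfl

lemma Elin_eq_basisMap (n : ℕ) : Elin n = basisMap (linHom n) := by
  rw [linHom, basisMap_list_prod, List.map_map]
  rfl

lemma LayU_mul_bitFlip {n : ℕ} (θ : Fin n → ℝ) (a : Fin n → Fin 2) :
    LayU n θ * bitFlip a = bitFlip (linHom n a) * LayU n θ := by
  rw [LayU, Matrix.mul_assoc, RXall_mul_bitFlip, ← Matrix.mul_assoc, Elin_eq_basisMap,
    basisMap_mul_bitFlip, Matrix.mul_assoc]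

lemma XtopM_eq_bitFlip (k : ℕ) : XtopM k = bitFlip (Pi.single (Fin.last k) 1) := by
  have h0 (w : Fin k → Fin 2) : Pi.single (Fin.last k) 1 + Fin.snoc (α := fun _ => Fin 2) w 0 =
      Fin.snoc (α := fun _ => Fin 2) w 1 := by
    ext i : 1
    refine Fin.lastCases ?_ (fun i => ?_) i <;> simp
  have h1 (w : Fin k → Fin 2) : Pi.single (Fin.last k) 1 + Fin.snoc (α := fun _ => Fin 2) w 1 =
      Fin.snoc (α := fun _ => Fin 2) w 0 := by
    rw [← h0, ← add_assoc, bits_add_self, zero_add]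
  ext u v
  obtain ⟨x, rfl⟩ := (splitE k).surjective u
  obtain ⟨y, rfl⟩ := (splitE k).surjective v
  rcases x with x | x <;> rcases y with y | y <;>
    simp [XtopM, bitFlip, basisMap, splitE, h0, h1, Matrix.one_apply, Fin.snoc_inj]

/-- `f` fixes the highest set bit of every bit string and sets none above it. -/
def FixesTopBit {n : ℕ} (f : AddMonoid.End (Fin n → Fin 2)) : Prop :=
  ∀ (a : Fin n → Fin 2) (i : Fin n), (∀ j, i < j → a j = 0) → ∀ j, i ≤ j → f a j = a j

lemma fixesTopBit_list_prod {n : ℕ} (l : List (AddMonoid.End (Fin n → Fin 2)))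
    (h : ∀ f ∈ l, FixesTopBit f) : FixesTopBit l.prod := by
  induction l with
  | nil => intro a i _ j _; rfl
  | cons f l ih =>
    intro a i ha j hj
    have hl := ih (fun g hg => h g (List.mem_cons_of_mem _ hg)) a i ha
    rw [List.prod_cons, AddMonoid.End.coe_mul, Function.comp_apply,
      h f List.mem_cons_self _ i (fun j hj => (hl j hj.le).trans (ha j hj)) j hj, hl j hj]

lemma fixesTopBit_linHom (n : ℕ) : FixesTopBit (linHom n) := by
  refine fixesTopBit_list_prod _ fun f hf => ?_
  obtain ⟨m, -, rfl⟩ := List.mem_map.1 hf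
  intro a i ha j hj
  change Function.update a _ _ j = a j
  rw [Function.update_apply]
  split_ifs with h
  · subst h
    rw [ha ⟨m.val + 1, _⟩ (Fin.lt_def.2 (Nat.lt_succ_of_le (Fin.le_def.1 hj))), add_zero]
  · rfl

lemma FixesTopBit.sub_one_pow_apply {n : ℕ} {f : AddMonoid.End (Fin n → Fin 2)}
    (hf : FixesTopBit f) (a : Fin n → Fin 2) (m : ℕ) (j : Fin n) (hj : n ≤ j + m) :
    ((f - 1) ^ m) a j = 0 := by
  induction m generalizing j with
  | zero => have := j.isLt; omega
  | succ m ih =>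
    rw [pow_succ', AddMonoid.End.coe_mul, Function.comp_apply]
    refine sub_eq_zero.2 ?_
    refine hf _ j (fun i hi => ih i ?_) j le_rfl
    have := Fin.lt_def.1 hi
    omega

lemma FixesTopBit.sub_one_pow_eq_zero {n : ℕ} {f : AddMonoid.End (Fin n → Fin 2)}
    (hf : FixesTopBit f) {m : ℕ} (hm : n ≤ m) : (f - 1) ^ m = 0 := by
  ext a j : 2
  exact hf.sub_one_pow_apply a m j (by omega)

lemma geom_sum_two_pow {R : Type*} [Ring R] [CharP R 2] (x : R) (m : ℕ) :
    ∑ i ∈ Finset.range (2 ^ m), x ^ i = (x - 1) ^ (2 ^ m - 1) := by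
  induction m with
  | zero => simp
  | succ m ih =>
    have h : (2 : ℕ) ^ (m + 1) - 1 = 2 ^ m + (2 ^ m - 1) := by
      have := Nat.one_le_two_pow (n := m)
      omega
    rw [pow_succ, mul_two, Finset.sum_range_add]
    simp only [pow_add x, ← Finset.mul_sum]
    rw [ih, ← mul_two, ← pow_succ, h, pow_add (x - 1),
      sub_pow_char_pow_of_commute (p := 2) m (Commute.one_right x), one_pow,
      CharTwo.sub_eq_add (x ^ 2 ^ m), add_mul, one_mul, add_comm]

lemma geom_sum_linHom_eq_zero (k t : ℕ) :
    ∑ i ∈ Finset.range (t * 2 ^ Nat.clog 2 (k + 2)), linHom (k + 1) ^ i = 0 := by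
  have : CharP (AddMonoid.End (Fin (k + 1) → Fin 2)) 2 := by
    refine CharTwo.of_one_ne_zero_of_two_eq_zero
      (fun h => one_ne_zero (congrFun (DFunLike.congr_fun h (fun _ => 1)) 0)) ?_
    refine one_add_one_eq_two.symm.trans ?_
    ext a : 1
    exact bits_add_self a
  have h : k + 2 ≤ 2 ^ Nat.clog 2 (k + 2) := Nat.le_pow_clog one_lt_two _
  induction t with
  | zero => simp
  | succ t ih =>
    rw [Nat.succ_mul, Finset.sum_range_add, ih, zero_add]
    simp only [pow_add, ← Finset.mul_sum]
    rw [geom_sum_two_pow, (fixesTopBit_linHom (k + 1)).sub_one_pow_eq_zero (by omega), mul_zero]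

lemma prod_map_compl {ι : Type*} {n : ℕ} (A : ι → Matrix (Fin n → Fin 2) (Fin n → Fin 2) ℂ)
    (f : AddMonoid.End (Fin n → Fin 2))
    (hA : ∀ i a, A i * bitFlip a = bitFlip (f a) * A i) (e : Fin n → Fin 2) (b : ι → Bool)
    (l : List ι) :
    (l.map fun i => A i * bitFlip e ^ (!b i).toNat).prod =
      bitFlip ((f * ∑ i ∈ Finset.range l.length, f ^ i) e) *
        (l.map fun i => A i * bitFlip e ^ (b i).toNat).prod := by
  have he (c : Bool) (a : Fin n → Fin 2) : bitFlip e ^ (!c).toNat * bitFlip a =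
      bitFlip (e + a) * bitFlip e ^ c.toNat := by
    cases c
    · simp [bitFlip_add]
    · simp [← bitFlip_add, add_right_comm, bits_add_self]
  induction l with
  | nil => simp [bitFlip_zero]
  | cons i l ih =>
    have hs : e + (f * ∑ i ∈ Finset.range l.length, f ^ i) e =
        (∑ i ∈ Finset.range (l.length + 1), f ^ i) e := by
      rw [Finset.sum_range_succ', Finset.mul_sum, add_comm]
      simp only [pow_succ', pow_zero]
      rfl
    rw [List.map_cons, List.map_cons, List.prod_cons, List.prod_cons, List.length_cons, ih,
      mul_assoc (A i), ← mul_assoc (_ ^ _), he, hs, ← mul_assoc (A i), ← mul_assoc (A i), hA]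
    simp only [mul_assoc]
    rfl

theorem stmt4 (k t : ℕ) (ht : 1 ≤ t)
    (θ : Fin (t * 2 ^ Nat.clog 2 (k + 2)) → (Fin (k + 1) → ℝ))
    (b : Fin (t * 2 ^ Nat.clog 2 (k + 2)) → Bool) :
    Gfun k θ b = Gfun k θ (fun j => ! b j) := by
  have key := prod_map_compl (fun j => LayU (k + 1) (θ j)) (linHom (k + 1))
    (fun j a => LayU_mul_bitFlip (θ j) a) (Pi.single (Fin.last k) 1) b
    (List.finRange (t * 2 ^ Nat.clog 2 (k + 2))).reverse
  rw [List.length_reverse, List.length_finRange, geom_sum_linHom_eq_zero, mul_zero,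
    AddMonoid.End.zero_apply, bitFlip_zero, one_mul, ← XtopM_eq_bitFlip] at key
  exact key.symm
end
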